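/- Let T > 0, let g : ℝ → ℝ be continuous, and let y, b : [0,T] → ℝ be continuous on [0,T], differentiable at every t ∈ (0,T), and satisfy y'(t) = g(y(t)) + b'(t) for all t ∈ (0,T), with y(0) = y⁰. Assume there exist constants N₀ ≥ 0 and N₁ ≥ 0 such that b(t₂) − b(t₁) ≤ N₀ + N₁(t₂ − t₁) for all 0 ≤ t₁ < t₂ ≤ T, and that there exists ζ̄ ∈ ℝ such that g(ζ) ≤ −N₁ for all ζ ≥ ζ̄. Then y(t) ≤ max{y⁰, ζ̄} + N₀ for all t ∈ [0,T]. -/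

import Mathlib

/-- **Zlotnik's inequality.** If `y' = g(y) + b'` on `(0, T)`, `b(t₂) - b(t₁) ≤ N₀ + N₁ (t₂ - t₁)`,
and `g(ζ) ≤ -N₁` for all `ζ ≥ ζ̄`, then `y(t) ≤ max (y 0, ζ̄) + N₀` on `[0, T]`. -/
theorem zlotnik_inequality (T : ℝ) (hT : 0 < T)
    (g : ℝ → ℝ) (hg : Continuous g)
    (y b : ℝ → ℝ) (y' b' : ℝ → ℝ)
    (hy_cont : ContinuousOn y (Set.Icc 0 T))
    (hb_cont : ContinuousOn b (Set.Icc 0 T))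
    (hy_deriv : ∀ t ∈ Set.Ioo 0 T, HasDerivAt y (y' t) t)
    (hb_deriv : ∀ t ∈ Set.Ioo 0 T, HasDerivAt b (b' t) t)
    (hode : ∀ t ∈ Set.Ioo 0 T, y' t = g (y t) + b' t)
    (y0 : ℝ) (hy0 : y 0 = y0)
    (N₀ N₁ : ℝ) (hN₀ : 0 ≤ N₀) (hN₁ : 0 ≤ N₁)
    (hb : ∀ t₁ t₂ : ℝ, 0 ≤ t₁ → t₁ < t₂ → t₂ ≤ T → b t₂ - b t₁ ≤ N₀ + N₁ * (t₂ - t₁))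
    (ζ : ℝ) (hζ : ∀ z : ℝ, ζ ≤ z → g z ≤ -N₁) :
    ∀ t ∈ Set.Icc 0 T, y t ≤ max y0 ζ + N₀ := by
  intro t ht
  by_contra! hlt
  set M := max y0 ζ with hM
  have hsub : Set.Icc 0 t ⊆ Set.Icc 0 T := Set.Icc_subset_Icc_right ht.2
  have hclosed : IsClosed (Set.Icc 0 t ∩ y ⁻¹' Set.Iic M) :=
    (hy_cont.mono hsub).preimage_isClosed_of_isClosed isClosed_Icc isClosed_Iic
  have hcompact : IsCompact (Set.Icc 0 t ∩ y ⁻¹' Set.Iic M) :=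
    isCompact_Icc.of_isClosed_subset hclosed Set.inter_subset_left
  have hne : (Set.Icc 0 t ∩ y ⁻¹' Set.Iic M).Nonempty :=
    ⟨0, ⟨le_rfl, ht.1⟩, by simp [hM, hy0]⟩
  -- `s` is the last time before `t` at which `y ≤ M`.
  obtain ⟨s, ⟨⟨hs0, hst⟩, hys⟩, hmax⟩ := hcompact.exists_isGreatest hne
  replace hys : y s ≤ M := hys
  have hst' : s < t := hst.lt_of_ne (by rintro rfl; linarith)
  have habove : ∀ x ∈ Set.Ioo s t, M < y x := fun x hx ↦ by
    by_contra! h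
    exact hx.1.not_ge (hmax ⟨⟨hs0.trans hx.1.le, hx.2.le⟩, h⟩)
  have hIcc : Set.Icc s t ⊆ Set.Icc 0 T := Set.Icc_subset_Icc hs0 ht.2
  have hIoo : Set.Ioo s t ⊆ Set.Ioo 0 T := Set.Ioo_subset_Ioo hs0 ht.2
  have hderiv : ∀ x ∈ Set.Ioo s t,
      HasDerivAt (fun x ↦ y x - b x + N₁ * x) (y' x - b' x + N₁ * 1) x := fun x hx ↦
    ((hy_deriv x (hIoo hx)).sub (hb_deriv x (hIoo hx))).add ((hasDerivAt_id x).const_mul N₁)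
  have hanti : AntitoneOn (fun x ↦ y x - b x + N₁ * x) (Set.Icc s t) := by
    refine antitoneOn_of_deriv_nonpos (convex_Icc s t)
      (((hy_cont.mono hIcc).sub (hb_cont.mono hIcc)).add (by fun_prop)) ?_ ?_ <;>
      rw [interior_Icc]
    · exact fun x hx ↦ (hderiv x hx).differentiableAt.differentiableWithinAt
    · intro x hx
      rw [(hderiv x hx).deriv, hode x (hIoo hx)]
      linarith [hζ (y x) ((le_max_right y0 ζ).trans (habove x hx).le)]
  have h := hanti (Set.left_mem_Icc.2 hst) (Set.right_mem_Icc.2 hst) hst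
  have hbst := hb s t hs0 hst' ht.2
  simp only at h
  linarith
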